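/- arXiv:1503.03462 — 2 statements merged into one kernel-verified Lean document; each statement's English description precedes it below -/
import Mathlib

section
/- Let a < b < c < d < e < f be real numbers and let P(t) = (t, t²). Suppose the three segments [P(a), P(d)], [P(b), P(e)], [P(c), P(f)] intersect concavely. Set α₁ = b − a, α₂ = c − b, β₁ = e − d, β₂ = f − e. Then α₁/β₁ > α₂/β₂. -/
/-- The point of the parabola `y = x²` with x-coordinate `t`. -/
noncomputable def Ppt (t : ℝ) : ℝ × ℝ := (t, t ^ 2)

/-- The closed straight-line segment between the points of the parabola with
x-coordinates `a` and `b`. -/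
noncomputable def Seg (a b : ℝ) : Set (ℝ × ℝ) := segment ℝ (Ppt a) (Ppt b)

theorem mem_Seg_aux (a d x y : ℝ) (h1 : a < x) (h2 : x < d) (hy : y = (a + d) * x - a * d) :
    (x, y) ∈ Seg a d := by
  have h : 0 < d - a := by linarith
  refine ⟨(d - x) / (d - a), (x - a) / (d - a), ?_, ?_, ?_, ?_⟩
  · exact div_nonneg (by linarith) h.le
  · exact div_nonneg (by linarith) h.le
  · field_simp
    ring
  · subst hy
    ext
    · simp [Ppt]
      field_simp
      ring
    · simp [Ppt]
      field_simp
      ring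

/-- Second claim of Lemma `lem_ratios`: if the chords `[P(a),P(d)]`, `[P(b),P(e)]`,
`[P(c),P(f)]` of the parabola (with `a < b < c < d < e < f`) intersect concavely,
then with `α₁ = b − a`, `α₂ = c − b`, `β₁ = e − d`, `β₂ = f − e` we have
`α₁/β₁ > α₂/β₂`. -/
theorem lem_ratios_second (a b c d e f : ℝ)
    (hab : a < b) (hbc : b < c) (hcd : c < d) (hde : d < e) (hef : e < f)
    (hconc : ∀ z w : ℝ × ℝ, z ∈ Seg c f ∩ Seg b e → w ∈ Seg b e ∩ Seg a d →
      z.1 < w.1) :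
    (b - a) / (e - d) > (c - b) / (f - e) := by
  have p1 : 0 < b - a := by linarith
  have p2 : 0 < c - b := by linarith
  have q1 : 0 < e - d := by linarith
  have q2 : 0 < f - e := by linarith
  obtain ⟨x1, hx1⟩ : ∃ x, x = (b * (e - d) + d * (b - a)) / ((b - a) + (e - d)) := ⟨_, rfl⟩
  obtain ⟨x2, hx2⟩ : ∃ x, x = (c * (f - e) + e * (c - b)) / ((c - b) + (f - e)) := ⟨_, rfl⟩
  have s1 : 0 < (b - a) + (e - d) := by linarith
  have s2 : 0 < (c - b) + (f - e) := by linarith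
  have b1 : b < x1 := by rw [hx1, lt_div_iff₀ s1]; nlinarith
  have b2 : x1 < d := by rw [hx1, div_lt_iff₀ s1]; nlinarith
  have b3 : c < x2 := by rw [hx2, lt_div_iff₀ s2]; nlinarith
  have b4 : x2 < e := by rw [hx2, div_lt_iff₀ s2]; nlinarith
  have e1 := (eq_div_iff s1.ne').1 hx1
  have e2 := (eq_div_iff s2.ne').1 hx2
  have key : x2 < x1 := hconc (x2, (b + e) * x2 - b * e) (x1, (b + e) * x1 - b * e)
    ⟨mem_Seg_aux _ _ _ _ b3 (by linarith) (by linarith),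
      mem_Seg_aux _ _ _ _ (by linarith) b4 rfl⟩
    ⟨mem_Seg_aux _ _ _ _ b1 (by linarith) rfl,
      mem_Seg_aux _ _ _ _ (by linarith) b2 (by linarith)⟩
  rw [hx1, hx2, div_lt_div_iff₀ s2 s1] at key
  rw [gt_iff_lt, div_lt_div_iff₀ q2 q1]
  by_contra hcon
  have hcon := not_lt.1 hcon
  have t1 := mul_nonneg (show 0 ≤ d - b by linarith) (sub_nonneg.2 hcon)
  have t2 := mul_pos (mul_pos p2 q2) s1
  have t3 := mul_pos (mul_pos q1 p2) s1
  linarith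
end

section
/- Let a < b < c < d < e < f be real numbers and let P(t) = (t, t²). Suppose the three segments [P(a), P(d)], [P(b), P(e)], [P(c), P(f)] intersect concavely. Set α₂ = c − b, γ = d − c, β₁ = e − d, β₂ = f − e. Then β₁ < β₂ or α₂ < γ + β₁ + β₂ (or both). -/
theorem mem_Seg_aux_s3 (p q x : ℝ) (hpq : p < q) (h1 : p ≤ x) (h2 : x ≤ q) :
    ((x, (p + q) * x - p * q) : ℝ × ℝ) ∈ Seg p q := by
  have hne : q - p ≠ 0 := by linarith
  have hpos : 0 < q - p := by linarith
  refine ⟨(q - x) / (q - p), (x - p) / (q - p), div_nonneg (by linarith) hpos.le,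
    div_nonneg (by linarith) hpos.le, ?_, ?_⟩
  · field_simp
    ring
  · ext
    · simp only [Ppt, Prod.fst_add, Prod.smul_fst, smul_eq_mul]
      field_simp
      ring
    · simp only [Ppt, Prod.snd_add, Prod.smul_snd, smul_eq_mul]
      field_simp
      ring

theorem inter_aux (p q r s : ℝ) (h1 : p < q) (h2 : q < r) (h3 : r < s) :
    ∃ z : ℝ × ℝ, z ∈ Seg q s ∧ z ∈ Seg p r ∧ z.1 * (q + s - p - r) = q * s - p * r ∧
      z.1 ≤ r := by
  have hD : 0 < q + s - p - r := by linarith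
  obtain ⟨x, hx⟩ : ∃ x : ℝ, x * (q + s - p - r) = q * s - p * r :=
    ⟨(q * s - p * r) / (q + s - p - r), by field_simp⟩
  have hq : q ≤ x := by
    by_contra! h
    nlinarith [mul_pos (sub_pos.2 h) hD, mul_pos (sub_pos.2 h1) (sub_pos.2 h2)]
  have hr : x ≤ r := by
    by_contra! h
    nlinarith [mul_pos (sub_pos.2 h) hD, mul_pos (sub_pos.2 h2) (sub_pos.2 h3)]
  refine ⟨(x, (q + s) * x - q * s), mem_Seg_aux_s3 q s x (by linarith) hq (by linarith), ?_, hx, hr⟩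
  have : (q + s) * x - q * s = (p + r) * x - p * r := by linarith
  rw [this]
  exact mem_Seg_aux_s3 p r x (by linarith) (by linarith) hr

/-- Third claim of Lemma `lem_ratios`: if the chords `[P(a),P(d)]`, `[P(b),P(e)]`,
`[P(c),P(f)]` of the parabola (with `a < b < c < d < e < f`) intersect concavely,
then with `α₂ = c − b`, `γ = d − c`, `β₁ = e − d`, `β₂ = f − e` we have
`β₁ < β₂` or `α₂ < γ + β₁ + β₂` (or both). -/
theorem lem_ratios_third (a b c d e f : ℝ)
    (hab : a < b) (hbc : b < c) (hcd : c < d) (hde : d < e) (hef : e < f)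
    (hconc : ∀ z w : ℝ × ℝ, z ∈ Seg c f ∩ Seg b e → w ∈ Seg b e ∩ Seg a d →
      z.1 < w.1) :
    e - d < f - e ∨ c - b < (d - c) + (e - d) + (f - e) := by
  obtain ⟨z, hz1, hz2, hz, -⟩ := inter_aux b c e f hbc (by linarith) hef
  obtain ⟨w, hw1, hw2, -, hw⟩ := inter_aux a b d e hab (by linarith) hde
  have hlt := hconc z w ⟨hz1, hz2⟩ ⟨hw1, hw2⟩
  have hzd : z.1 < d := lt_of_lt_of_le hlt hw
  by_contra! hcon
  obtain ⟨k1, k2⟩ := hcon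
  have hD : 0 < c + f - b - e := by linarith
  have hm := mul_pos (sub_pos.2 hzd) hD
  have key : (e - d) * (c - b) < (d - c) * (f - e) := by nlinarith
  have k3 : (d - c) * (f - e) ≤ (c - b) * (e - d) :=
    mul_le_mul (by linarith) k1 (by linarith) (by linarith)
  linarith
end
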